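/- Let Λ be an Artin algebra, M a finitely generated Λ-module with Γ = End_Λ(M)^{op}, and suppose add(M) is an n-cluster tilting subcategory of mod-Λ (so gl.dim Γ ≤ n+1 and M is a generator-cogenerator with Ext^i_Λ(M,M) = 0 for 1 ≤ i ≤ n−1). Let X be an arbitrary (possibly infinitely generated) Λ-module with Ext^i_Λ(M, X) = 0 for all 1 ≤ i ≤ n−1. Then X lies in Add(M), i.e., X is a direct summand of a (possibly infinite) direct sum of copies of M. -/

import Mathlib

open CategoryTheory Limits DirectSum

namespace Paper

variable {Λ : Type} [Ring Λ]

/-- `N` is a direct summand of `P` (there is a section/retraction pair). -/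
def IsSummand (N P : ModuleCat Λ) : Prop :=
  ∃ (s : N ⟶ P) (r : P ⟶ N), s ≫ r = 𝟙 N

/-- `Add 𝓧`: all direct summands of arbitrary direct sums of objects of `𝓧`. -/
def AddCl (𝓧 : Set (ModuleCat Λ)) : Set (ModuleCat Λ) :=
  {N | ∃ (ι : Type) (X : ι → ModuleCat Λ), (∀ i, X i ∈ 𝓧) ∧
        IsSummand N (ModuleCat.of Λ (⨁ i, X i))}

/-- `add 𝓧`: all direct summands of finite direct sums of objects of `𝓧`. -/
def addCl (𝓧 : Set (ModuleCat Λ)) : Set (ModuleCat Λ) :=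
  {N | ∃ (k : ℕ) (X : Fin k → ModuleCat Λ), (∀ i, X i ∈ 𝓧) ∧
        IsSummand N (ModuleCat.of Λ (⨁ i, X i))}

/-- Vanishing of `Ext^i(X, Y)` in `Mod Λ`. -/
def extZero (i : ℕ) (X Y : ModuleCat Λ) : Prop :=
  Limits.IsZero (((Ext ℤ (ModuleCat Λ) i).obj (Opposite.op X)).obj Y)

/-- `𝓜` is an `n`-cluster tilting subcategory of the full subcategory `𝓐 ⊆ Mod Λ`:
it is a generating-cogenerating, functorially finite subcategory of `𝓐` which
coincides with both `Ext`-orthogonality classes (for `1 ≤ i ≤ n-1`) inside `𝓐`. -/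
structure IsNClusterTilting (n : ℕ) (𝓐 𝓜 : Set (ModuleCat Λ)) : Prop where
  subset : 𝓜 ⊆ 𝓐
  generating : ∀ A ∈ 𝓐, ∃ M ∈ 𝓜, ∃ f : M ⟶ A, Function.Surjective f
  cogenerating : ∀ A ∈ 𝓐, ∃ M ∈ 𝓜, ∃ f : A ⟶ M, Function.Injective f
  contFinite : ∀ A ∈ 𝓐, ∃ M ∈ 𝓜, ∃ f : M ⟶ A,
    ∀ N ∈ 𝓜, ∀ g : N ⟶ A, ∃ h : N ⟶ M, h ≫ f = g
  covFinite : ∀ A ∈ 𝓐, ∃ M ∈ 𝓜, ∃ f : A ⟶ M,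
    ∀ N ∈ 𝓜, ∀ g : A ⟶ N, ∃ h : M ⟶ N, f ≫ h = g
  char_left : ∀ X ∈ 𝓐, (X ∈ 𝓜 ↔ ∀ i, 0 < i → i < n → ∀ M ∈ 𝓜, extZero i X M)
  char_right : ∀ X ∈ 𝓐, (X ∈ 𝓜 ↔ ∀ i, 0 < i → i < n → ∀ M ∈ 𝓜, extZero i M X)

/-- The class of finitely generated Λ-modules (the subcategory `mod Λ`). -/
def modFG (Λ : Type) [Ring Λ] : Set (ModuleCat Λ) := {M | Module.Finite Λ M}


/-!
STATEMENT 3: Let Λ be an Artin algebra, `M` a finitely generated Λ-module such that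
`add M` is an `n`-cluster tilting subcategory of `mod Λ`.  If `X` is an arbitrary
Λ-module with `Ext^i(M, X) = 0` for all `1 ≤ i ≤ n-1`, then `X ∈ Add M`.
-/

section Splitting

variable {Λ : Type} [Ring Λ] {M X I : Type} [AddCommGroup M] [Module Λ M]
  [AddCommGroup X] [Module Λ X]

/-- A set of prescribed values is finitely consistent with local sections of `π`. -/
def Consistent (π : (I →₀ M) →ₗ[Λ] X) (G : Set (X × (I →₀ M))) : Prop :=
  ∀ A : Submodule Λ X, A.FG → ∀ G0 : Finset (X × (I →₀ M)), (G0 : Set (X × (I →₀ M))) ⊆ G →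
    ∃ t : A →ₗ[Λ] (I →₀ M), (∀ a, π (t a) = a) ∧ ∀ p ∈ G0, ∀ h : p.1 ∈ A, t ⟨p.1, h⟩ = p.2

/-- The subgroup of possible values at `x` of maps killing the given points. -/
def valSub (R : Type) [CommRing R] [Module R M] [SMulCommClass Λ R M] (x : X)
    (A : Submodule Λ X) (G0 : Finset (X × (I →₀ M))) : Submodule R M where
  carrier := {m | ∃ t : A →ₗ[Λ] M, (∀ p ∈ G0, ∀ h : p.1 ∈ A, t ⟨p.1, h⟩ = 0) ∧
    ∀ h : x ∈ A, t ⟨x, h⟩ = m}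
  add_mem' := by
    rintro a b ⟨t, ht, hx⟩ ⟨t', ht', hx'⟩
    exact ⟨t + t', fun p hp h => by simp [ht p hp h, ht' p hp h],
      fun h => by simp [hx h, hx' h]⟩
  zero_mem' := ⟨0, by simp, by simp⟩
  smul_mem' := by
    rintro r a ⟨t, ht, hx⟩
    exact ⟨r • t, fun p hp h => by simp [ht p hp h], fun h => by simp [hx h]⟩

theorem valSub_anti (R : Type) [CommRing R] [Module R M] [SMulCommClass Λ R M] (x : X)
    {A A' : Submodule Λ X} {G0 G0' : Finset (X × (I →₀ M))} (hA : A ≤ A') (hG : G0 ⊆ G0')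
    (hx : x ∈ A) :
    valSub R x A' G0' ≤ valSub R x A G0 := by
  rintro m ⟨t, ht, htx⟩
  refine ⟨t ∘ₗ Submodule.inclusion hA, fun p hp h => ?_, fun h => ?_⟩
  · exact ht p (hG hp) (hA h)
  · exact htx (hA h)

theorem consistent_insert (R : Type) [CommRing R] [Module R M] [SMulCommClass Λ R M]
    [IsArtinian R M] (π : (I →₀ M) →ₗ[Λ] X)
    (hπ : ∀ (N : Type) [AddCommGroup N] [Module Λ N], Module.Finite Λ N →
      ∀ g : N →ₗ[Λ] X, ∃ t : N →ₗ[Λ] (I →₀ M), π ∘ₗ t = g)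
    (G : Set (X × (I →₀ M))) (hG : Consistent π G) (x : X) :
    ∃ y, Consistent π (insert (x, y) G) := by
  classical
  -- choose minimal
  obtain ⟨W, ⟨A, hA, hxA, G0, hG0, rfl⟩, hmin⟩ :=
    (wellFounded_lt (α := Submodule R M)).has_min
      {W | ∃ A : Submodule Λ X, A.FG ∧ x ∈ A ∧ ∃ G0 : Finset (X × (I →₀ M)),
        (G0 : Set (X × (I →₀ M))) ⊆ G ∧ valSub R x A G0 = W}
      ⟨_, Submodule.span Λ {x}, Submodule.fg_span_singleton x,
        Submodule.mem_span_singleton_self x, ∅, by simp, rfl⟩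
  obtain ⟨t0, ht0, ht0G⟩ := hG A hA G0 hG0
  refine ⟨t0 ⟨x, hxA⟩, ?_⟩
  intro A' hA' G0' hG0'
  set y := t0 ⟨x, hxA⟩ with hy
  have hle : A ≤ A ⊔ A' := le_sup_left
  have hle' : A' ≤ A ⊔ A' := le_sup_right
  have hA2 : (A ⊔ A').FG := hA.sup hA'
  have hG2 : ((G0 ∪ G0'.erase (x, y) : Finset (X × (I →₀ M))) : Set (X × (I →₀ M))) ⊆ G := by
    intro p hp
    simp only [Finset.coe_union, Set.mem_union, Finset.mem_coe, Finset.mem_erase] at hp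
    rcases hp with hp | ⟨hne, hp⟩
    · exact hG0 hp
    · rcases hG0' hp with h | h
      · exact absurd h hne
      · exact h
  generalize hA2' : A ⊔ A' = A2 at *
  generalize hG2' : G0 ∪ G0'.erase (x, y) = G2 at *
  have hGsub : G0 ⊆ G2 := hG2' ▸ Finset.subset_union_left
  obtain ⟨t2, ht2, ht2G⟩ := hG A2 hA2 G2 hG2
  have hW : valSub R x A G0 = valSub R x A2 G2 := by
    by_contra hne
    exact hmin _ ⟨A2, hA2, hle hxA, G2, hG2, rfl⟩
      (lt_of_le_of_ne (valSub_anti R x hle hGsub hxA) (Ne.symm hne))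
  have hx2 : x ∈ A2 := hle hxA
  -- the difference
  have hd : ∀ i, (y - t2 ⟨x, hx2⟩) i ∈ valSub R x A2 G2 := by
    intro i
    rw [← hW]
    refine ⟨Finsupp.lapply i ∘ₗ (t0 - t2 ∘ₗ Submodule.inclusion hle), fun p hp h => ?_,
      fun h => ?_⟩
    · have h1 := ht0G p hp h
      have h2 := ht2G p (hGsub hp) (hle h)
      simp only [LinearMap.comp_apply, LinearMap.sub_apply, h1, Finsupp.lapply_apply]
      change (p.2 - t2 ⟨p.1, hle h⟩) i = 0
      rw [h2]; simp
    · rfl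
  choose u hu hux using hd
  let D := y - t2 ⟨x, hx2⟩
  let U : A2 →ₗ[Λ] (I →₀ M) := ∑ i ∈ D.support, Finsupp.lsingle i ∘ₗ u i
  have hU : ∀ p ∈ G2, ∀ h : p.1 ∈ A2, U ⟨p.1, h⟩ = 0 := by
    intro p hp h
    simp only [U, LinearMap.sum_apply, LinearMap.comp_apply]
    exact Finset.sum_eq_zero fun i _ => by rw [hu i p hp h, map_zero]
  have hUx : U ⟨x, hx2⟩ = D := by
    simp only [U, LinearMap.sum_apply, LinearMap.comp_apply, hux]
    exact D.sum_single
  have hπD : π D = 0 := by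
    simp only [D, map_sub, ht2, hy, ht0, sub_self]
  let Z : Submodule Λ A2 := Submodule.span Λ {a | a.1 = x ∨ ∃ p ∈ G2, p.1 = a.1}
  have hZ : Z ≤ LinearMap.ker (π ∘ₗ U) := by
    refine Submodule.span_le.2 ?_
    rintro ⟨a, ha⟩ (h | ⟨p, hp, h⟩)
    · simp only at h
      subst h
      simp [hUx, hπD]
    · simp only at h
      subst h
      simp [hU p hp ha]
  have : Module.Finite Λ A2 := Module.Finite.iff_fg.2 hA2
  obtain ⟨u', hu'⟩ := hπ (A2 ⧸ Z) inferInstance (Z.liftQ (π ∘ₗ U) hZ)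
  have hπu' : ∀ a : A2, π (u' (Z.mkQ a)) = π (U a) := by
    intro a
    have := LinearMap.congr_fun hu' (Z.mkQ a)
    simpa using this
  have hu'Z : ∀ a ∈ Z, u' (Z.mkQ a) = 0 := by
    intro a ha
    rw [Submodule.mkQ_apply, (Submodule.Quotient.mk_eq_zero Z).2 ha, map_zero]
  let t : A2 →ₗ[Λ] (I →₀ M) := t2 + (U - u' ∘ₗ Z.mkQ)
  have htx : t ⟨x, hx2⟩ = y := by
    have : u' (Z.mkQ ⟨x, hx2⟩) = 0 := hu'Z _ (Submodule.subset_span (Or.inl rfl))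
    simp only [t, LinearMap.add_apply, LinearMap.sub_apply, LinearMap.comp_apply, this, hUx, D]
    abel
  have htG : ∀ p ∈ G2, ∀ h : p.1 ∈ A2, t ⟨p.1, h⟩ = p.2 := by
    intro p hp h
    have : u' (Z.mkQ ⟨p.1, h⟩) = 0 := hu'Z _ (Submodule.subset_span (Or.inr ⟨p, hp, rfl⟩))
    simp only [t, LinearMap.add_apply, LinearMap.sub_apply, LinearMap.comp_apply, this, hU p hp h,
      ht2G p hp h]
    abel
  have htπ : ∀ a, π (t a) = a := by
    intro a
    simp only [t, LinearMap.add_apply, LinearMap.sub_apply, LinearMap.comp_apply, map_add, map_sub,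
      hπu', ht2]
    abel
  refine ⟨t ∘ₗ Submodule.inclusion hle', fun a => htπ _, fun p hp h => ?_⟩
  by_cases hpe : p = (x, y)
  · subst hpe
    exact htx
  · exact htG p (hG2' ▸ Finset.mem_union_right _ (Finset.mem_erase.2 ⟨hpe, hp⟩)) (hle' h)

theorem exists_section (R : Type) [CommRing R] [Module R M] [SMulCommClass Λ R M]
    [IsArtinian R M] (π : (I →₀ M) →ₗ[Λ] X)
    (hπ : ∀ (N : Type) [AddCommGroup N] [Module Λ N], Module.Finite Λ N →
      ∀ g : N →ₗ[Λ] X, ∃ t : N →ₗ[Λ] (I →₀ M), π ∘ₗ t = g) :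
    ∃ σ : X →ₗ[Λ] (I →₀ M), π ∘ₗ σ = LinearMap.id := by
  classical
  obtain ⟨G, hG⟩ := zorn_subset {G | Consistent π G} (by
    intro c hc hchain
    by_cases hne : c.Nonempty
    · refine ⟨⋃₀ c, ?_, fun s hs => Set.subset_sUnion_of_mem hs⟩
      intro A hA G0 hG0
      obtain ⟨s, hs, hsub⟩ := hchain.directedOn.exists_mem_subset_of_finset_subset_biUnion
        (f := id) hne (s := G0) (by simpa [Set.sUnion_eq_biUnion] using hG0)
      exact hc hs A hA G0 hsub
    · refine ⟨∅, ?_, fun s hs => absurd ⟨s, hs⟩ hne⟩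
      intro A hA G0 hG0
      obtain ⟨t, ht⟩ := hπ A (Module.Finite.iff_fg.2 hA) A.subtype
      refine ⟨t, fun a => LinearMap.congr_fun ht a, fun p hp => absurd (hG0 hp) (by simp)⟩)
  have hcons : Consistent π G := hG.prop
  have htot : ∀ x, ∃ y, (x, y) ∈ G := by
    intro x
    obtain ⟨y, hy⟩ := consistent_insert R π hπ G hcons x
    exact ⟨y, hG.le_of_ge hy (Set.subset_insert _ _) (Set.mem_insert _ _)⟩
  choose σ hσ using htot
  have key : ∀ S : Finset X, ∃ t : Submodule.span Λ (S : Set X) →ₗ[Λ] (I →₀ M),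
      (∀ a, π (t a) = a) ∧ ∀ x (h : x ∈ S), t ⟨x, Submodule.subset_span h⟩ = σ x := by
    intro S
    obtain ⟨t, ht, htG⟩ := hcons (Submodule.span Λ (S : Set X)) ⟨S, rfl⟩
      (S.image fun x => (x, σ x)) (by
        intro p hp
        simp only [Finset.coe_image, Set.mem_image] at hp
        obtain ⟨x, -, rfl⟩ := hp
        exact hσ x)
    exact ⟨t, ht, fun x h => htG (x, σ x) (Finset.mem_image_of_mem _ h) _⟩
  refine ⟨{ toFun := σ, map_add' := ?_, map_smul' := ?_ }, ?_⟩
  · intro a b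
    obtain ⟨t, -, ht⟩ := key {a, b, a + b}
    rw [← ht a (by simp), ← ht b (by simp), ← ht (a + b) (by simp), ← map_add]
    rfl
  · intro r a
    obtain ⟨t, -, ht⟩ := key {a, r • a}
    rw [← ht a (by simp), ← ht (r • a) (by simp), RingHom.id_apply, ← map_smul]
    rfl
  · ext x
    obtain ⟨t, hπt, ht⟩ := key {x}
    have := ht x (by simp)
    simp only [LinearMap.comp_apply, LinearMap.coe_mk, AddHom.coe_mk, LinearMap.id_apply]
    rw [← this, hπt]

end Splitting

section ExtPart

variable {Λ : Type} [Ring Λ]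

theorem extZero_iff (i : ℕ) (hi : 0 < i) (X Y : ModuleCat.{0} Λ) :
    extZero i X Y ↔ Subsingleton (Abelian.Ext X Y i) := by
  obtain ⟨p, rfl⟩ : ∃ p, i = p + 1 := ⟨i - 1, by omega⟩
  let P := projectiveResolution X
  have h1 : extZero (p + 1) X Y ↔ ∀ f : P.complex.X (p + 1) ⟶ Y,
      P.complex.d (p + 2) (p + 1) ≫ f = 0 → ∃ g : P.complex.X p ⟶ Y,
        P.complex.d (p + 1) p ≫ g = f := by
    unfold extZero
    rw [(P.isoExt (R := ℤ) (p + 1) Y).isZero_iff,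
      ← HomologicalComplex.exactAt_iff_isZero_homology,
      HomologicalComplex.exactAt_iff' _ p (p + 1) (p + 2) (by simp) (by simp),
      ShortComplex.moduleCat_exact_iff]
    exact Iff.rfl
  rw [h1]
  constructor
  · intro h
    refine ⟨fun a b => ?_⟩
    have hz : ∀ a : Abelian.Ext X Y (p + 1), a = 0 := by
      intro a
      obtain ⟨f, hf, rfl⟩ := P.extMk_surjective a (p + 2) rfl
      exact (P.extMk_eq_zero_iff f (p + 2) rfl hf p rfl).2 (h f hf)
    rw [hz a, hz b]
  · intro h f hf
    exact (P.extMk_eq_zero_iff f (p + 2) rfl hf p rfl).1 (Subsingleton.elim _ _)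

theorem exists_decomp {M N : ModuleCat.{0} Λ} (hN : N ∈ addCl {M}) :
    ∃ (k : ℕ) (a : Fin k → (N ⟶ M)) (b : Fin k → (M ⟶ N)), ∑ j, a j ≫ b j = 𝟙 N := by
  classical
  obtain ⟨k, Z, hZ, s, r, hsr⟩ := hN
  obtain rfl : Z = fun _ => M := funext fun i => by simpa using hZ i
  refine ⟨k, fun j => s ≫ ModuleCat.ofHom (DirectSum.component Λ (Fin k) (fun _ => M) j),
    fun j => ModuleCat.ofHom (DirectSum.lof Λ (Fin k) (fun _ => M) j) ≫ r, ?_⟩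
  rw [← hsr]
  ext x
  simp only [ModuleCat.hom_sum, LinearMap.sum_apply, ModuleCat.hom_comp, LinearMap.comp_apply,
    ModuleCat.hom_ofHom]
  rw [← map_sum]
  congr 1
  exact DirectSum.sum_univ_of (s.hom x)

theorem ext_of_add {M N Y : ModuleCat.{0} Λ} (hN : N ∈ addCl {M}) (i : ℕ)
    (h : Subsingleton (Abelian.Ext M Y i)) : Subsingleton (Abelian.Ext N Y i) := by
  obtain ⟨k, a, b, hab⟩ := exists_decomp hN
  have hz : ∀ α : Abelian.Ext N Y i, α = 0 := by
    intro α
    rw [← Abelian.Ext.mk₀_id_comp α, ← hab, Abelian.Ext.mk₀_sum, Abelian.Ext.sum_comp]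
    refine Finset.sum_eq_zero fun j _ => ?_
    rw [← Abelian.Ext.mk₀_comp_mk₀_assoc,
      Subsingleton.elim ((Abelian.Ext.mk₀ (b j)).comp α (zero_add i)) 0, Abelian.Ext.comp_zero]
  exact ⟨fun a b => by rw [hz a, hz b]⟩

/-- Every map from a finitely generated module to `X` factors through `add M`. -/
theorem factor_through_add (n : ℕ) (hn : 0 < n) (M : ModuleCat.{0} Λ)
    (h : IsNClusterTilting n (modFG Λ) (addCl {M})) (X : ModuleCat.{0} Λ)
    (hX : ∀ i, 0 < i → i < n → extZero i M X)
    (N : ModuleCat.{0} Λ) (hN : Module.Finite Λ N) (g : N ⟶ X) :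
    ∃ M' ∈ addCl {M}, ∃ (f : N ⟶ M') (g' : M' ⟶ X), f ≫ g' = g := by
  have hX' : ∀ M' ∈ addCl {M}, ∀ i, 0 < i → i < n → Subsingleton (Abelian.Ext M' X i) :=
    fun M' hM' i h0 hi => ext_of_add hM' i ((extZero_iff i h0 _ _).1 (hX i h0 hi))
  have hself : ∀ M' ∈ addCl {M}, ∀ M'' ∈ addCl {M}, ∀ i, 0 < i → i < n →
      Subsingleton (Abelian.Ext M' M'' i) := fun M' hM' M'' hM'' i h0 hi =>
    (extZero_iff i h0 _ _).1 ((h.char_left M' (h.subset hM')).1 hM' i h0 hi M'' hM'')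
  have happ : ∀ A : ModuleCat.{0} Λ, Module.Finite Λ A → ∃ S : ShortComplex (ModuleCat.{0} Λ),
      S.ShortExact ∧ S.X₁ = A ∧ S.X₂ ∈ addCl {M} ∧ Module.Finite Λ S.X₃ ∧
      ∀ M' ∈ addCl {M}, ∀ u : S.X₁ ⟶ M', ∃ v : S.X₂ ⟶ M', S.f ≫ v = u := by
    intro A hA
    obtain ⟨M0, hM0, f, hf⟩ := h.covFinite A hA
    obtain ⟨M1, hM1, f1, hf1⟩ := h.cogenerating A hA
    obtain ⟨v, hv⟩ := hf M1 hM1 f1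
    have : Mono f := by
      have : Mono f1 := (ModuleCat.mono_iff_injective f1).2 hf1
      rw [← hv] at this
      exact mono_of_mono f v
    have hfin : Module.Finite Λ M0 := h.subset hM0
    refine ⟨ShortComplex.mk f (cokernel.π f) (cokernel.condition f), ?_, rfl, hM0, ?_, hf⟩
    · exact ShortComplex.ShortExact.mk (ShortComplex.exact_cokernel f)
    · exact Module.Finite.of_surjective (cokernel.π f).hom
        ((ModuleCat.epi_iff_surjective (cokernel.π f)).1 inferInstance)
  -- cokernels of approximations have one more vanishing Ext
  have hstep : ∀ (S : ShortComplex (ModuleCat.{0} Λ)) (hS : S.ShortExact),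
      S.X₂ ∈ addCl {M} → (∀ M' ∈ addCl {M}, ∀ u : S.X₁ ⟶ M', ∃ v : S.X₂ ⟶ M', S.f ≫ v = u) →
      ∀ j, j + 1 < n →
      (∀ i, 0 < i → i ≤ j → ∀ M' ∈ addCl {M}, Subsingleton (Abelian.Ext S.X₁ M' i)) →
      (∀ i, 0 < i → i ≤ j + 1 → ∀ M' ∈ addCl {M}, Subsingleton (Abelian.Ext S.X₃ M' i)) := by
    intro S hS hS2 hext j hj hj1 i h0 hi M' hM'
    have hz : ∀ α : Abelian.Ext S.X₃ M' i, α = 0 := by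
      intro α
      obtain ⟨q, rfl⟩ : ∃ q, i = 1 + q := ⟨i - 1, by omega⟩
      have := hself S.X₂ hS2 M' hM' (1 + q) h0 (by omega)
      obtain ⟨β, rfl⟩ := Abelian.Ext.contravariant_sequence_exact₃ hS M' α
        (Subsingleton.elim _ _) rfl
      rcases Nat.eq_zero_or_pos q with rfl | hq
      · obtain ⟨u, rfl⟩ := (Abelian.Ext.mk₀_bijective _ _).2 β
        obtain ⟨v, rfl⟩ := hext M' hM' u
        rw [← Abelian.Ext.mk₀_comp_mk₀, ← Abelian.Ext.comp_assoc_of_second_deg_zero]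
        simp
      · have := hj1 q hq (by omega) M' hM'
        rw [Subsingleton.elim β 0, Abelian.Ext.comp_zero]
    exact ⟨fun a b => by rw [hz a, hz b]⟩
  -- downward induction
  have hQ : ∀ d j, 0 < j → j + d + 1 = n → ∀ A : ModuleCat.{0} Λ, Module.Finite Λ A →
      (∀ i, 0 < i → i ≤ j → ∀ M' ∈ addCl {M}, Subsingleton (Abelian.Ext A M' i)) →
      Subsingleton (Abelian.Ext A X j) := by
    intro d
    induction d with
    | zero =>
      intro j hj hjn A hA hext
      refine hX' A ((h.char_left A hA).2 fun i h0 hi M' hM' => ?_) j hj (by omega)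
      exact (extZero_iff i h0 _ _).2 (hext i h0 (by omega) M' hM')
    | succ d ih =>
      intro j hj hjn A hA hext
      obtain ⟨S, hS, rfl, hS2, hS3, happS⟩ := happ A hA
      have h3 := ih (j + 1) (by omega) (by omega) S.X₃ hS3
        (hstep S hS hS2 happS j (by omega) hext)
      have h2 := hX' S.X₂ hS2 j hj (by omega)
      have hz : ∀ α : Abelian.Ext S.X₁ X j, α = 0 := by
        intro α
        obtain ⟨β, rfl⟩ := Abelian.Ext.contravariant_sequence_exact₁ hS X α
          (n₁ := j + 1) (add_comm _ _) (Subsingleton.elim _ _)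
        rw [Subsingleton.elim β 0, Abelian.Ext.comp_zero]
      exact ⟨fun a b => by rw [hz a, hz b]⟩
  rcases Nat.lt_or_ge 1 n with h1 | h1
  · obtain ⟨S, hS, rfl, hS2, hS3, happS⟩ := happ N hN
    have h3 := hQ (n - 2) 1 one_pos (by omega) S.X₃ hS3
      (hstep S hS hS2 happS 0 (by omega) (fun i h0 hi => by omega))
    obtain ⟨β, hβ⟩ := Abelian.Ext.contravariant_sequence_exact₁ hS X (Abelian.Ext.mk₀ g)
      (n₁ := 1) rfl (Subsingleton.elim _ _)
    obtain ⟨v, rfl⟩ := (Abelian.Ext.mk₀_bijective _ _).2 β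
    refine ⟨S.X₂, hS2, S.f, v, ?_⟩
    rw [Abelian.Ext.mk₀_comp_mk₀] at hβ
    exact (Abelian.Ext.mk₀_bijective _ _).1 hβ
  · exact ⟨N, (h.char_left N hN).2 fun i h0 hi => by omega, 𝟙 N, g, Category.id_comp g⟩

end ExtPart

theorem stmt3 (R : Type) [CommRing R] [IsArtinianRing R]
    [Algebra R Λ] [Module.Finite R Λ]
    (n : ℕ) (hn : 0 < n) (M : ModuleCat Λ) (hM : Module.Finite Λ M)
    (h : IsNClusterTilting n (modFG Λ) (addCl {M}))
    (X : ModuleCat Λ)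
    (hX : ∀ i, 0 < i → i < n → extZero i M X) :
    X ∈ AddCl {M} := by
  classical
  letI : Module R M := Module.compHom M (algebraMap R Λ)
  haveI : IsScalarTower R Λ M := IsScalarTower.of_algebraMap_smul fun _ _ => rfl
  haveI : SMulCommClass R Λ M := IsScalarTower.to_smulCommClass
  haveI : SMulCommClass Λ R M := SMulCommClass.symm R Λ M
  haveI : Module.Finite R M := Module.Finite.trans Λ M
  haveI : IsArtinian R M := inferInstance
  let π : ((M →ₗ[Λ] X) →₀ M) →ₗ[Λ] X := Finsupp.lsum ℕ fun f => f
  have hπ : ∀ (N : Type) [AddCommGroup N] [Module Λ N], Module.Finite Λ N →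
      ∀ g : N →ₗ[Λ] X, ∃ t : N →ₗ[Λ] ((M →ₗ[Λ] X) →₀ M), π ∘ₗ t = g := by
    intro N _ _ hN g
    obtain ⟨M', hM', f, g', hfg⟩ := factor_through_add n hn M h X hX (ModuleCat.of Λ N) hN
      (ModuleCat.ofHom g)
    obtain ⟨k, a, b, hab⟩ := exists_decomp hM'
    refine ⟨∑ j, Finsupp.lsingle (b j ≫ g').hom ∘ₗ (f ≫ a j).hom, ?_⟩
    have h1 : f ≫ (∑ j, a j ≫ b j) ≫ g' = ModuleCat.ofHom g := by
      rw [hab, Category.id_comp, hfg]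
    ext x
    have h2 := congrArg (fun φ => φ.hom x) h1
    simp only [ModuleCat.hom_comp, ModuleCat.hom_sum, LinearMap.comp_apply, LinearMap.sum_apply,
      map_sum, ModuleCat.hom_ofHom] at h2
    simp only [LinearMap.comp_apply, LinearMap.sum_apply, map_sum]
    rw [← h2]
    refine Finset.sum_congr rfl fun j _ => ?_
    simp [π]
  obtain ⟨σ, hσ⟩ := exists_section R π hπ
  let e := finsuppLEquivDirectSum Λ M (M →ₗ[Λ] X)
  refine ⟨M →ₗ[Λ] X, fun _ => M, fun _ => rfl, ModuleCat.ofHom (e.toLinearMap ∘ₗ σ),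
    ModuleCat.ofHom (π ∘ₗ e.symm.toLinearMap), ?_⟩
  ext x
  have := LinearMap.congr_fun hσ x
  simpa using this

end Paper
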